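/- Let f₀ be a FISI polynomial of degree d ≥ 2 and let P be a one-parameter deformation of f₀ such that W₀ ∩ {φ_d = 0} = ∅ (no [x] ∈ ℙ^{n−1} satisfies ∂P_d/∂x_i(x,0) = 0 for all i together with ∂P_d/∂s(x,0) = 0). Then P is a general-at-infinity deformation: there exists ε > 0 such that for every s with 0 < |s| < ε the polynomial f_s is general-at-infinity, i.e. for every t ∈ ℂ the projective closure of f_s^{-1}(t) is transverse to the hyperplane at infinity; equivalently, the only common zero in ℂⁿ of the partial derivatives ∂P_d/∂x_1(·,s),…,∂P_d/∂x_n(·,s) is the origin. -/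

import Mathlib

open MvPolynomial Filter CategoryTheory Limits Topology

noncomputable section

abbrev XS (n : ℕ) := Fin n ⊕ Unit
abbrev HV (n : ℕ) := Fin n ⊕ Unit
abbrev TV (n : ℕ) := Fin n ⊕ Fin 3

/-- ℙ^{n-1}, the hyperplane at infinity of ℙⁿ. -/
abbrev PrjInf (n : ℕ) := Projectivization ℂ (Fin n → ℂ)
/-- ℙⁿ. -/
abbrev Prj (n : ℕ) := Projectivization ℂ (HV n → ℂ)

/-- weights for the degree in the `x`-variables only: `s` has weight `0`. -/
def wtx (n : ℕ) : XS n → ℕ := Sum.elim (fun _ => 1) (fun _ => 0)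

/-- `P_q`, the degree-`q` homogeneous part of `P` in the variables `x`. -/
def xpart {n : ℕ} (P : MvPolynomial (XS n) ℂ) (q : ℕ) : MvPolynomial (XS n) ℂ :=
  weightedHomogeneousComponent (wtx n) q P

/-- the evaluation point `(x, s)`. -/
def evA {n : ℕ} (x : Fin n → ℂ) (s : ℂ) : XS n → ℂ := Sum.elim x (fun _ => s)

/-- `deg_x P(·,s) = d` at the parameter value `s`. -/
def DegXAt {n : ℕ} (d : ℕ) (P : MvPolynomial (XS n) ℂ) (s : ℂ) : Prop :=
  (∀ q, d < q → ∀ x : Fin n → ℂ, eval (evA x s) (xpart P q) = 0) ∧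
  (∃ x : Fin n → ℂ, eval (evA x s) (xpart P d) ≠ 0)

/-- the substitution embedding the variables `(x,s)` into the variables `(x,x₀,s,t)`. -/
def embT {n : ℕ} : XS n → MvPolynomial (TV n) ℂ :=
  Sum.elim (fun i => X (Sum.inl i)) (fun _ => X (Sum.inr 1))

/-- The defining polynomial `F = P̃(x,x₀,s) - t·x₀^d` of the total space
`Y ⊂ ℙⁿ × ℂ_s × ℂ_t`, where `P̃ = Σ_{q ≤ d} x₀^{d-q} P_q(x,s)` is the homogenization
of `P` in `x` by the variable `x₀`. -/
def FY {n : ℕ} (d : ℕ) (P : MvPolynomial (XS n) ℂ) : MvPolynomial (TV n) ℂ :=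
  (∑ q ∈ Finset.range (d+1), (X (Sum.inr 0))^(d-q) * aeval embT (xpart P q))
    - X (Sum.inr 2) * (X (Sum.inr 0))^d

/-- the evaluation point `((x,x₀), s, t)` of the variables of `FY`. -/
def evT {n : ℕ} (u : HV n → ℂ) (s t : ℂ) : TV n → ℂ :=
  Sum.elim (fun i => u (Sum.inl i)) ![u (Sum.inr ()), s, t]

/-- `([u], s, t) ∈ Y`. -/
def OnY {n : ℕ} (d : ℕ) (P : MvPolynomial (XS n) ℂ) (u : HV n → ℂ) (s t : ℂ) : Prop :=
  eval (evT u s t) (FY d P) = 0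

/-- all partial derivatives of the defining equation of `Y` — with respect to the
homogeneous coordinates `(x, x₀)` and the affine coordinates `s, t` — vanish at
`([u], s, t)`; together with `OnY` this says `([u],s,t)` is a singular point of `Y`. -/
def AllDerivsVanish {n : ℕ} (d : ℕ) (P : MvPolynomial (XS n) ℂ) (u : HV n → ℂ)
    (s t : ℂ) : Prop :=
  ∀ v : TV n, eval (evT u s t) (pderiv v (FY d P)) = 0

/-- the partial derivatives with respect to the homogeneous coordinates `(x, x₀)`
vanish at `([u], s, t)`; together with `OnY` this says `[u]` is a singular point of the
projective fiber `Y_{s,t}`. -/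
def FiberDerivsVanish {n : ℕ} (d : ℕ) (P : MvPolynomial (XS n) ℂ) (u : HV n → ℂ)
    (s t : ℂ) : Prop :=
  (∀ i : Fin n, eval (evT u s t) (pderiv (Sum.inl i) (FY d P)) = 0) ∧
    eval (evT u s t) (pderiv (Sum.inr 0) (FY d P)) = 0

/-- the partial derivatives with respect to `(x, x₀)` and `t` (but not `s`) vanish;
together with `OnY` this identifies the singular points of `Y_{s,ℂ}`, resp. the critical
points of the projection `σ : Y → ℂ_s`. -/
def SliceDerivsVanish {n : ℕ} (d : ℕ) (P : MvPolynomial (XS n) ℂ) (u : HV n → ℂ)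
    (s t : ℂ) : Prop :=
  FiberDerivsVanish d P u s t ∧ eval (evT u s t) (pderiv (Sum.inr 2) (FY d P)) = 0

/-- `[x] ∈ W_s`: all `∂P_d/∂x_i` vanish at `(x,s)`. -/
def WCond {n : ℕ} (d : ℕ) (P : MvPolynomial (XS n) ℂ) (x : Fin n → ℂ) (s : ℂ) : Prop :=
  ∀ i : Fin n, eval (evA x s) (pderiv (Sum.inl i) (xpart P d)) = 0

/-- `[x] ∈ Σ_s`: moreover `P_{d-1}(x,s) = 0`. -/
def SCond {n : ℕ} (d : ℕ) (P : MvPolynomial (XS n) ℂ) (x : Fin n → ℂ) (s : ℂ) : Prop :=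
  WCond d P x s ∧ eval (evA x s) (xpart P (d-1)) = 0

/-- `φ_d(x) = ∂P_d/∂s (x, 0) = 0`. -/
def PhiCond {n : ℕ} (d : ℕ) (P : MvPolynomial (XS n) ℂ) (x : Fin n → ℂ) : Prop :=
  eval (evA x 0) (pderiv (Sum.inr ()) (xpart P d)) = 0

/-- `W_s ⊂ ℙ^{n-1}` as a set of projective points. -/
def Wset {n : ℕ} (d : ℕ) (P : MvPolynomial (XS n) ℂ) (s : ℂ) : Set (PrjInf n) :=
  {p | WCond d P p.rep s}

/-- `Σ_s ⊂ ℙ^{n-1}` as a set of projective points. -/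
def Sigset {n : ℕ} (d : ℕ) (P : MvPolynomial (XS n) ℂ) (s : ℂ) : Set (PrjInf n) :=
  {p | SCond d P p.rep s}

/-- `f_s = P(·,s)` as a polynomial in `x`. -/
def fS {n : ℕ} (P : MvPolynomial (XS n) ℂ) (s : ℂ) : MvPolynomial (Fin n) ℂ :=
  aeval (Sum.elim X (fun _ => C s)) P

/-- `x` is an affine critical point of `f_s`, i.e. `∂P/∂x_i(x,s) = 0` for all `i`. -/
def CritPt {n : ℕ} (P : MvPolynomial (XS n) ℂ) (x : Fin n → ℂ) (s : ℂ) : Prop :=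
  ∀ i : Fin n, eval (evA x s) (pderiv (Sum.inl i) P) = 0

/-- the set of singular points of the compactified fiber `Y_{s,t} ⊂ ℙⁿ`. -/
def SingYst {n : ℕ} (d : ℕ) (P : MvPolynomial (XS n) ℂ) (s t : ℂ) : Set (Prj n) :=
  {p | OnY d P p.rep s t ∧ FiberDerivsVanish d P p.rep s t}

/-- `f₀ = P(·,0)` is a FISI polynomial: it has finitely many critical points, the
projective closure of each of its fibers has only isolated (= finitely many) singular
points, and the singular locus `W₀` of the slice at infinity is finite. -/
def FISIat {n : ℕ} (d : ℕ) (P : MvPolynomial (XS n) ℂ) (s : ℂ) : Prop :=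
  {x : Fin n → ℂ | CritPt P x s}.Finite ∧ (∀ t : ℂ, (SingYst d P s t).Finite) ∧
    (Wset d P s).Finite

/-- `P` is a FISI deformation: `f₀` is FISI, `W₀` is finite and every `f_s`, for `s` in a
neighbourhood of `0`, has only finitely many critical points. -/
def FISIdef {n : ℕ} (d : ℕ) (P : MvPolynomial (XS n) ℂ) : Prop :=
  FISIat d P 0 ∧ ∃ ε > (0:ℝ), ∀ s : ℂ, ‖s‖ < ε → {x : Fin n → ℂ | CritPt P x s}.Finite

/-- The "Milnor-type" local dimension: given polynomial germs `gs` at a point `a ∈ ℂᵐ`,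
this is the `ℂ`-dimension of the formal power series ring at `a` (identified with
`ℂ[[X]]` via `X ↦ X - a`) modulo the ideal generated by the germs. -/
def germDim {m : ℕ} (gs : Set (MvPolynomial (Fin m) ℂ)) (a : Fin m → ℂ) : ℕ :=
  Module.finrank ℂ (MvPowerSeries (Fin m) ℂ ⧸ Ideal.span
    ((fun g => (MvPolynomial.coeToMvPowerSeries.ringHom
        (aeval (fun i => X i + C (a i)) g) : MvPowerSeries (Fin m) ℂ)) '' gs))

/-- the (choice of an) index `j` with `p.rep j ≠ 0`, used to normalize `v_j = 1`
and to work in the chart `x_j = 1` of `ℙⁿ`. -/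
def jp {n : ℕ} (p : PrjInf n) : Fin n :=
  (Function.ne_iff.mp p.rep_nonzero).choose

lemma jp_spec {n : ℕ} (p : PrjInf n) : p.rep (jp p) ≠ 0 :=
  (Function.ne_iff.mp p.rep_nonzero).choose_spec

/-- the chart coordinates of the point at infinity `p = [v:0]`, where `v` is normalized
by `v_{j(p)} = 1`, in the chart `x_{j(p)} = 1` of `ℙⁿ`; the slot `j(p)` of the chart
carries the coordinate `x₀`, which is `0` at `p`. -/
def chartPt {n : ℕ} (p : PrjInf n) : Fin n → ℂ :=
  fun i => if i = jp p then 0 else p.rep i / p.rep (jp p)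

/-- the chart equation of the compactified fiber `Y_{s,t}` in the chart `x_j = 1` of
`ℙⁿ`: substitute `x_j = 1` in the homogeneous defining equation `FY`, the chart slot `j`
carrying the coordinate `x₀`. -/
def chartEq {n : ℕ} (d : ℕ) (P : MvPolynomial (XS n) ℂ) (j : Fin n) (s t : ℂ) :
    MvPolynomial (Fin n) ℂ :=
  aeval (Sum.elim (fun i => if i = j then 1 else X i) ![X j, C s, C t]) (FY d P)

/-- the chart equation of the hypersurface `{P_d(·,s) = 0} ⊂ ℙ^{n-1}` in the chart
`x_j = 1` of `ℙ^{n-1}` (the chart variable `X j` is unused). -/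
def chartEqInf {n : ℕ} (d : ℕ) (P : MvPolynomial (XS n) ℂ) (j : Fin n) (s : ℂ) :
    MvPolynomial (Fin n) ℂ :=
  aeval (fun i => if i = j then 1 else X i) (aeval (Sum.elim X (fun _ => C s)) (xpart P d))

/-- `μ_p(t,s)`, the Milnor number of the isolated singularity of the compactified fiber
`Y_{s,t}` at the point `p` of the hyperplane at infinity. -/
def muP {n : ℕ} (d : ℕ) (P : MvPolynomial (XS n) ℂ) (p : PrjInf n) (s t : ℂ) : ℕ :=
  germDim (Set.range fun i => pderiv i (chartEq d P (jp p) s t)) (chartPt p)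

/-- `μ_{p,gen}(s) = min_{t ∈ ℂ} μ_p(t,s)`. -/
def muGen {n : ℕ} (d : ℕ) (P : MvPolynomial (XS n) ℂ) (p : PrjInf n) (s : ℂ) : ℕ :=
  sInf (Set.range (muP d P p s))

/-- the local Milnor–Lê number `λ_{p,t}(s) = μ_p(t,s) − μ_{p,gen}(s)`. -/
def lamP {n : ℕ} (d : ℕ) (P : MvPolynomial (XS n) ℂ) (p : PrjInf n) (t s : ℂ) : ℕ :=
  muP d P p s t - muGen d P p s

/-- `μ_p^∞(s)`, the Milnor number at `p` of the hypersurface `{P_d(·,s)=0} ⊂ ℙ^{n-1}`: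
computed in the chart `x_{j(p)} = 1`, adding the generator `X (j p)` to kill the unused
chart variable. -/
def muInf {n : ℕ} (d : ℕ) (P : MvPolynomial (XS n) ℂ) (p : PrjInf n) (s : ℂ) : ℕ :=
  germDim ({g | ∃ i, i ≠ jp p ∧ g = pderiv i (chartEqInf d P (jp p) s)} ∪ {X (jp p)})
    (chartPt p)

/-- the total Milnor number `μ(s)` of the affine singularities of `f_s`. -/
def muTot {n : ℕ} (P : MvPolynomial (XS n) ℂ) (s : ℂ) : ℕ :=
  Module.finrank ℂ (MvPolynomial (Fin n) ℂ ⧸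
    Ideal.span (Set.range fun i => pderiv i (fS P s)))

/-- the local Milnor number `μ_a(f_s)` of `f_s` at the point `a ∈ ℂⁿ`. -/
def muAt {n : ℕ} (P : MvPolynomial (XS n) ℂ) (s : ℂ) (a : Fin n → ℂ) : ℕ :=
  germDim (Set.range fun i => pderiv i (fS P s)) a

/-- the total Milnor–Lê number at infinity `λ(s) = Σ_{p ∈ Σ_s} Σ_{t ∈ ℂ} λ_{p,t}(s)`
(all but finitely many summands vanish). -/
def lamTot {n : ℕ} (d : ℕ) (P : MvPolynomial (XS n) ℂ) (s : ℂ) : ℕ :=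
  ∑ᶠ p ∈ Sigset d P s, ∑ᶠ t : ℂ, lamP d P p t s

/-- the chart coordinates of the affine point `[x : 1] ∈ ℙⁿ` in the chart `x_j = 1`,
the slot `j` carrying the coordinate `x₀` (i.e. `1/x_j`). -/
def chartCo {n : ℕ} (j : Fin n) (x : Fin n → ℂ) : Fin n → ℂ :=
  fun i => if i = j then 1 / x j else x i / x j

/-- the affine discriminant `Δ_P ⊂ ℂ_s × ℂ_t`: the closure of the set of pairs
`(s, f_s(x))` over the affine critical points `x` of `f_s`. -/
def DeltaP {n : ℕ} (P : MvPolynomial (XS n) ℂ) : Set (ℂ × ℂ) :=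
  closure {w : ℂ × ℂ | ∃ x : Fin n → ℂ, CritPt P x w.1 ∧ w.2 = eval (evA x w.1) P}

lemma exists_section_of_transcendental {K B : Type} [Field K] [Algebra ℂ K]
    [Algebra.EssFiniteType ℂ K] [CommRing B] [Algebra ℂ B] (π : B →ₐ[ℂ] K)
    (hπ : Function.Surjective π) (hker : IsNilpotent (RingHom.ker (π : B →+* K)))
    (s : K) (hs : Transcendental ℂ s) (b : B) (hb : π b = s) :
    ∃ φ : K →ₐ[ℂ] B, (∀ x, π (φ x) = x) ∧ φ s = b := by
  let : Algebra (Polynomial ℂ) K := (Polynomial.aeval s).toRingHom.toAlgebra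
  let : Algebra (Polynomial ℂ) B := (Polynomial.aeval b).toRingHom.toAlgebra
  have hK : ∀ p : Polynomial ℂ, algebraMap (Polynomial ℂ) K p = Polynomial.aeval s p :=
    fun _ => rfl
  have hB : ∀ p : Polynomial ℂ, algebraMap (Polynomial ℂ) B p = Polynomial.aeval b p :=
    fun _ => rfl
  have : IsScalarTower ℂ (Polynomial ℂ) K := .of_algebraMap_eq fun c => by
    rw [hK, Polynomial.algebraMap_apply]; simp
  have : IsScalarTower ℂ (Polynomial ℂ) B := .of_algebraMap_eq fun c => by
    rw [hB, Polynomial.algebraMap_apply]; simp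
  have : FaithfulSMul (Polynomial ℂ) K := by
    rw [faithfulSMul_iff_algebraMap_injective]
    exact transcendental_iff_injective.mp hs
  let : Algebra (FractionRing (Polynomial ℂ)) K := FractionRing.liftAlgebra _ K
  have : IsScalarTower (Polynomial ℂ) (FractionRing (Polynomial ℂ)) K :=
    FractionRing.isScalarTower_liftAlgebra _ K
  have : IsScalarTower ℂ (FractionRing (Polynomial ℂ)) K :=
    IsScalarTower.to₁₃₄ _ (Polynomial ℂ) _ _
  have : Algebra.EssFiniteType (FractionRing (Polynomial ℂ)) K :=
    Algebra.EssFiniteType.of_comp ℂ _ _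
  have : CharZero (FractionRing (Polynomial ℂ)) :=
    charZero_of_injective_algebraMap (algebraMap ℂ (FractionRing (Polynomial ℂ))).injective
  have : Algebra.FormallySmooth (FractionRing (Polynomial ℂ)) K := inferInstance
  have : Algebra.FormallySmooth (Polynomial ℂ) (FractionRing (Polynomial ℂ)) :=
    .of_isLocalization (nonZeroDivisors _)
  have : Algebra.FormallySmooth (Polynomial ℂ) K :=
    .comp _ (FractionRing (Polynomial ℂ)) _
  let π' : B →ₐ[Polynomial ℂ] K :=
    { (π : B →+* K) with
      commutes' := fun p => by
        change π (Polynomial.aeval b p) = Polynomial.aeval s p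
        rw [← Polynomial.aeval_algHom_apply, hb] }
  let ψ : K →ₐ[Polynomial ℂ] B :=
    Algebra.FormallySmooth.liftOfSurjective (AlgHom.id _ K) π' hπ hker
  refine ⟨ψ.restrictScalars ℂ, fun x => ?_, ?_⟩
  · exact Algebra.FormallySmooth.liftOfSurjective_apply (AlgHom.id _ K) π' hπ hker x
  · have h := ψ.commutes Polynomial.X
    rw [hK, hB] at h
    simpa using h

lemma snd_aeval_dual {σ K : Type} [Fintype σ] [Field K] [Algebra ℂ K]
    (v : σ → DualNumber K) (p : MvPolynomial σ ℂ) :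
    (aeval v p).fst = aeval (fun i => (v i).fst) p ∧
    (aeval v p).snd = ∑ i, aeval (fun i => (v i).fst) (pderiv i p) * (v i).snd := by
  classical
  induction p using MvPolynomial.induction_on with
  | C a =>
    simp [TrivSqZeroExt.algebraMap_eq_inl']
  | add p q hp hq =>
    simp [hp.1, hp.2, hq.1, hq.2, add_mul, Finset.sum_add_distrib]
  | mul_X p j hp =>
    refine ⟨by simp [hp.1], ?_⟩
    simp only [map_mul, aeval_X, TrivSqZeroExt.snd_mul, hp.1, hp.2, Derivation.leibniz,
      pderiv_X, smul_eq_mul, map_add, add_mul, Finset.sum_add_distrib, Pi.single_apply,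
      MulOpposite.smul_eq_mul_unop, MulOpposite.unop_op, apply_ite, map_one, map_zero]
    simp [Finset.sum_mul]
    refine Finset.sum_congr rfl fun i _ => by ring

/-- Algebraic Sard lemma. -/
lemma prime_dichotomy {n : ℕ} (g : MvPolynomial (XS n) ℂ) (q : Ideal (MvPolynomial (XS n) ℂ))
    [q.IsPrime] (hg : g ∈ q) (hgi : ∀ i : Fin n, pderiv (Sum.inl i) g ∈ q) :
    pderiv (Sum.inr ()) g ∈ q ∨ ∃ c : ℂ, X (Sum.inr ()) - C c ∈ q := by
  let A := MvPolynomial (XS n) ℂ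
  let K := FractionRing (A ⧸ q)
  let ι : A →ₐ[ℂ] K := (IsScalarTower.toAlgHom ℂ (A ⧸ q) K).comp (Ideal.Quotient.mkₐ ℂ q)
  have hι : ∀ a : A, ι a = 0 ↔ a ∈ q := fun a => by
    have h1 : ι a = algebraMap (A ⧸ q) K (Ideal.Quotient.mk q a) := rfl
    rw [h1, map_eq_zero_iff _ (IsFractionRing.injective (A ⧸ q) K), Ideal.Quotient.eq_zero_iff_mem]
  by_cases hs : Transcendental ℂ (ι (X (Sum.inr ())))
  · left
    have : Algebra.EssFiniteType ℂ K := inferInstance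
    obtain ⟨φ, h1, h2⟩ := exists_section_of_transcendental (B := DualNumber K)
      (TrivSqZeroExt.fstHom ℂ K K) (fun x => ⟨TrivSqZeroExt.inl x, rfl⟩)
      ⟨2, by
        rw [pow_two, Ideal.zero_eq_bot, eq_bot_iff, Ideal.mul_le]
        intro r hr t ht
        have hr' : r.fst = 0 := hr
        have ht' : t.fst = 0 := ht
        rw [Ideal.mem_bot]
        ext <;> simp [hr', ht']⟩
      (ι (X (Sum.inr ()))) hs
      (TrivSqZeroExt.inl (ι (X (Sum.inr ()))) + TrivSqZeroExt.inr 1) (by simp)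
    have h1' : ∀ x, (φ x).fst = x := h1
    have key : ∀ p : A, φ (ι p) = aeval (fun i => φ (ι (X i))) p := fun p => by
      have := MvPolynomial.aeval_unique (φ.comp ι)
      exact DFunLike.congr_fun this p
    have key2 : ∀ p : A, aeval (fun i => ι (X i)) p = ι p := fun p => by
      have := MvPolynomial.aeval_unique ι
      exact (DFunLike.congr_fun this p).symm
    have h3 := (snd_aeval_dual (fun i => φ (ι (X i))) g).2
    rw [← key, (hι g).2 hg, map_zero, Fintype.sum_sum_type] at h3
    simp only [h1', key2] at h3
    rw [Finset.sum_eq_zero (fun i _ => by rw [(hι _).2 (hgi i), zero_mul])] at h3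
    simp [h2] at h3
    exact (hι _).1 h3.symm
  · right
    have hint : IsIntegral ℂ (ι (X (Sum.inr ()))) := by
      rw [Transcendental, not_not] at hs
      exact hs.isIntegral
    obtain ⟨c, hc⟩ := minpoly.mem_range_of_degree_eq_one ℂ _
      (IsAlgClosed.degree_eq_one_of_irreducible ℂ (minpoly.irreducible hint))
    refine ⟨c, (hι _).1 ?_⟩
    rw [map_sub, ← hc, ← algebraMap_eq, AlgHom.commutes, sub_self]

lemma eval_scale {n m : ℕ} {p : MvPolynomial (XS n) ℂ} (hp : p.IsWeightedHomogeneous (wtx n) m)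
    (c : ℂ) (x : Fin n → ℂ) (s : ℂ) :
    eval (evA (c • x) s) p = c ^ m * eval (evA x s) p := by
  rw [eval_eq, eval_eq, Finset.mul_sum]
  refine Finset.sum_congr rfl fun e he => ?_
  have h := hp (mem_support_iff.mp he)
  have h' : ∑ i : Fin n, e (Sum.inl i) = m := by
    rw [← h, Finsupp.weight_apply, Finsupp.sum_fintype _ _ (by simp)]
    simp [wtx]
  rw [← Finsupp.prod, ← Finsupp.prod, Finsupp.prod_fintype _ _ (by simp),
    Finsupp.prod_fintype _ _ (by simp)]
  simp [evA, mul_pow, Finset.prod_mul_distrib, Finset.prod_pow_eq_pow_sum, h']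
  ring

/-- If `W₀ ∩ {φ_d = 0} = ∅` then `P` is a general-at-infinity
deformation: for every `s` with `0 < |s| < ε` the polynomial `f_s` is general-at-infinity,
i.e. the only common zero in `ℂⁿ` of `∂P_d/∂x_1(·,s), …, ∂P_d/∂x_n(·,s)` is the origin
(equivalently, every compactified fiber of `f_s` is transverse to the hyperplane at
infinity). -/
theorem stmt5 {n d : ℕ} (hn : 2 ≤ n) (hd : 2 ≤ d) (P : MvPolynomial (XS n) ℂ)
    (hdeg : ∃ ε > (0:ℝ), ∀ s : ℂ, ‖s‖ < ε → DegXAt d P s)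
    (hfisi : FISIat d P 0)
    (hphi : ¬ ∃ x : Fin n → ℂ, x ≠ 0 ∧ WCond d P x 0 ∧ PhiCond d P x) :
    ∃ ε > (0:ℝ), ∀ s : ℂ, 0 < ‖s‖ → ‖s‖ < ε →
      ∀ x : Fin n → ℂ, WCond d P x s → x = 0 := by
  classical
  set g := xpart P d with hgdef
  have hgh : g.IsWeightedHomogeneous (wtx n) d :=
    weightedHomogeneousComponent_isWeightedHomogeneous d P
  have hgi : ∀ i : Fin n, (pderiv (Sum.inl i) g).IsWeightedHomogeneous (wtx n) (d - 1) :=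
    fun i => hgh.pderiv (by simp [wtx]; omega)
  have scale : ∀ (c : ℂ) (x : Fin n → ℂ) (s : ℂ), WCond d P x s → WCond d P (c • x) s := by
    intro c x s h i
    rw [eval_scale (hgi i), h i, mul_zero]
  -- the Jacobian ideal and its minimal primes
  let J : Ideal (MvPolynomial (XS n) ℂ) :=
    Ideal.span (Set.range fun i : Fin n => pderiv (Sum.inl i) g)
  have hJi : ∀ i : Fin n, pderiv (Sum.inl i) g ∈ J := fun i => Ideal.subset_span ⟨i, rfl⟩
  have hJg : g ∈ J := by
    have h := hgh.sum_weight_X_mul_pderiv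
    have h2 : d • g ∈ J := by
      rw [← h, Fintype.sum_sum_type]
      refine J.add_mem (J.sum_mem fun i _ => ?_) ?_
      · exact nsmul_mem (J.mul_mem_left _ (hJi i)) _
      · simp [wtx]
    have h3 : C ((d : ℂ)⁻¹) * (d • g) = g := by
      have hd0 : (d : ℂ) ≠ 0 := by exact_mod_cast (by omega : d ≠ 0)
      rw [nsmul_eq_mul, ← mul_assoc, ← map_natCast (C : ℂ →+* MvPolynomial (XS n) ℂ),
        ← C_mul, inv_mul_cancel₀ hd0, C_1, one_mul]
    rw [← h3]
    exact J.mul_mem_left _ h2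
  have hfin : J.minimalPrimes.Finite := J.finite_minimalPrimes_of_isNoetherianRing _
  let S : Set ℂ := {c | ∃ q ∈ J.minimalPrimes, X (Sum.inr ()) - C c ∈ q}
  have hS : S.Finite := by
    have : S = ⋃ q ∈ J.minimalPrimes, {c | X (Sum.inr ()) - C c ∈ q} := by
      ext c; simp [S]
    rw [this]
    refine hfin.biUnion fun q hq => Set.Subsingleton.finite ?_
    intro a ha b hb
    by_contra hab
    have : q.IsPrime := hq.1.1
    have h1 : C (b - a) ∈ q := by
      have := q.sub_mem ha hb
      simpa using this
    exact Ideal.IsPrime.ne_top ‹_› (Ideal.eq_top_of_isUnit_mem _ h1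
      ((IsUnit.mk0 (b - a) (sub_ne_zero.2 (Ne.symm hab))).map C))
  have dich : ∀ (x : Fin n → ℂ) (s : ℂ), WCond d P x s → s ∉ S →
      eval (evA x s) (pderiv (Sum.inr ()) g) = 0 := by
    intro x s hx hs
    let m : Ideal (MvPolynomial (XS n) ℂ) := RingHom.ker (eval (evA x s))
    have : m.IsPrime := RingHom.ker_isPrime _
    have hJm : J ≤ m := by
      rw [Ideal.span_le]
      rintro _ ⟨i, rfl⟩
      exact hx i
    obtain ⟨q, hq, hqm⟩ := Ideal.exists_minimalPrimes_le hJm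
    have : q.IsPrime := hq.1.1
    rcases prime_dichotomy g q (hq.1.2 hJg) (fun i => hq.1.2 (hJi i)) with h | ⟨c, hc⟩
    · exact hqm h
    · have h1 : eval (evA x s) (X (Sum.inr ()) - C c) = 0 := hqm hc
      have h2 : s = c := by
        simpa [evA, sub_eq_zero] using h1
      exact absurd ⟨q, hq, h2 ▸ hc⟩ hs
  -- compactness
  have hcont : ∀ p : MvPolynomial (XS n) ℂ,
      Continuous fun z : (Fin n → ℂ) × ℂ => eval (evA z.1 z.2) p := by
    intro p
    refine (MvPolynomial.continuous_eval p).comp ?_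
    refine continuous_pi fun i => ?_
    rcases i with i | i
    · exact (continuous_apply i).comp continuous_fst
    · exact continuous_snd
  let T : Set ((Fin n → ℂ) × ℂ) :=
    (Metric.sphere 0 1 ×ˢ Metric.closedBall 0 1) ∩
      ({z | WCond d P z.1 z.2} ∩ {z | eval (evA z.1 z.2) (pderiv (Sum.inr ()) g) = 0})
  have hT : IsCompact T := by
    refine ((isCompact_sphere 0 1).prod (isCompact_closedBall 0 1)).inter_right ?_
    refine IsClosed.inter ?_ (isClosed_eq (hcont _) continuous_const)
    have : {z : (Fin n → ℂ) × ℂ | WCond d P z.1 z.2} =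
        ⋂ i : Fin n, {z | eval (evA z.1 z.2) (pderiv (Sum.inl i) g) = 0} := by
      ext z; simp [WCond, g]
    rw [this]
    exact isClosed_iInter fun i => isClosed_eq (hcont _) continuous_const
  have hclosed : IsClosed (Prod.snd '' T ∪ (S \ {0})) :=
    (hT.image continuous_snd).isClosed.union (hS.subset Set.sdiff_subset).isClosed
  have h0 : (0 : ℂ) ∈ (Prod.snd '' T ∪ (S \ {0}))ᶜ := by
    rintro (⟨⟨x, s⟩, ⟨⟨hx, -⟩, hW, hp⟩, hs⟩ | h)
    · simp only at hs hx
      subst hs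
      refine hphi ⟨x, ?_, hW, hp⟩
      rintro rfl
      simp at hx
    · exact h.2 rfl
  obtain ⟨ε, hε, hball⟩ := Metric.isOpen_iff.1 hclosed.isOpen_compl 0 h0
  refine ⟨min ε 1, by positivity, fun s hs0 hs x hx => ?_⟩
  by_contra hx0
  have hsS : s ∉ S := fun h => hball (show s ∈ Metric.ball 0 ε by
    simpa using lt_of_lt_of_le hs (min_le_left _ _)) (Or.inr ⟨h, by simpa using hs0⟩)
  have hW := scale ((‖x‖ : ℂ)⁻¹) x s hx
  refine hball (show s ∈ Metric.ball 0 ε by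
    simpa using lt_of_lt_of_le hs (min_le_left _ _)) (Or.inl ⟨(((‖x‖ : ℂ)⁻¹) • x, s),
      ⟨⟨?_, ?_⟩, hW, dich _ _ hW hsS⟩, rfl⟩)
  · have : ‖x‖ ≠ 0 := by simpa using hx0
    simp [norm_smul, this]
  · simpa using (lt_of_lt_of_le hs (min_le_right _ _)).le
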